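/- arXiv:2202.02272 — 5 statements merged into one kernel-verified Lean document; each statement's English description precedes it below -/
import Mathlib

section
/- Let n, L be positive integers, and for each ℓ = 1,…,L let P_ℓ be a symmetric positive definite real n_ℓ × n_ℓ matrix and G_ℓ a real n_ℓ × n matrix, such that M := ∑_{ℓ=1}^L G_ℓᵀ P_ℓ⁻¹ G_ℓ is invertible. Then for every family of real n × n_ℓ matrices A_ℓ satisfying the unbiasedness constraint ∑_{ℓ=1}^L A_ℓ G_ℓ = I_n, one has trace(∑_{ℓ=1}^L A_ℓ P_ℓ A_ℓᵀ) ≥ trace(M⁻¹), and equality holds for the optimal weights A_ℓ = M⁻¹ G_ℓᵀ P_ℓ⁻¹. -/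
open Matrix BigOperators

/-- The optimal weights satisfy `P i * (B i)ᵀ = G i * M⁻¹`. -/
theorem mul_transpose_optimalWeight {m n : Type*} [Fintype m] [DecidableEq m] [Fintype n]
    [DecidableEq n]
    {P : Matrix m m ℝ} (hP : P.PosDef) (G : Matrix m n ℝ)
    {M : Matrix n n ℝ} (hM : Mᵀ = M) :
    P * (M⁻¹ * Gᵀ * P⁻¹)ᵀ = G * M⁻¹ := by
  have hPt : Pᵀ = P := by simpa using hP.isHermitian.eq
  have hPu : IsUnit P.det := (isUnit_iff_isUnit_det P).1 hP.isUnit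
  rw [transpose_mul, transpose_mul, transpose_nonsing_inv, transpose_nonsing_inv, hPt, hM,
    transpose_transpose, mul_nonsing_inv_cancel_left _ _ hPu]

/-- The information matrix `∑ i, (G i)ᵀ * (P i)⁻¹ * G i` is symmetric. -/
theorem transpose_sum_transpose_mul_inv_mul {ι n : Type*} [Fintype ι] {d : ι → Type*}
    [∀ i, Fintype (d i)] [∀ i, DecidableEq (d i)]
    {P : ∀ i, Matrix (d i) (d i) ℝ}
    (hP : ∀ i, (P i).PosDef) (G : ∀ i, Matrix (d i) n ℝ) :
    (∑ i, (G i)ᵀ * (P i)⁻¹ * G i)ᵀ = ∑ i, (G i)ᵀ * (P i)⁻¹ * G i := by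
  rw [transpose_sum]
  refine Finset.sum_congr rfl fun i _ => ?_
  have hPt : (P i)ᵀ = P i := by simpa using (hP i).isHermitian.eq
  rw [transpose_mul, transpose_mul, transpose_nonsing_inv, hPt, transpose_transpose,
    Matrix.mul_assoc]

/-- The covariance of any weights `A` against the optimal weights is `M⁻¹` as soon as `A` is
unbiased. -/
theorem sum_mul_mul_transpose_optimalWeight {ι n : Type*} [Fintype ι] [Fintype n] [DecidableEq n] {d : ι → Type*}
    [∀ i, Fintype (d i)] [∀ i, DecidableEq (d i)]
    {P : ∀ i, Matrix (d i) (d i) ℝ}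
    (hP : ∀ i, (P i).PosDef) (G : ∀ i, Matrix (d i) n ℝ) {M : Matrix n n ℝ} (hM : Mᵀ = M)
    {A : ∀ i, Matrix n (d i) ℝ} (hA : ∑ i, A i * G i = 1) :
    ∑ i, A i * P i * (M⁻¹ * (G i)ᵀ * (P i)⁻¹)ᵀ = M⁻¹ := by
  simp_rw [Matrix.mul_assoc (A _), mul_transpose_optimalWeight (hP _) _ hM,
    ← Matrix.mul_assoc (A _)]
  rw [← Finset.sum_mul, hA, Matrix.one_mul]

/-- If the weights `B` satisfy `∑ i, A i * P i * (B i)ᵀ = ∑ i, B i * P i * (B i)ᵀ`, then the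
covariance of `B` has trace at most that of `A`. -/
theorem trace_sum_mul_mul_transpose_le {ι n : Type*} [Fintype ι] [Fintype n] {d : ι → Type*}
    [∀ i, Fintype (d i)]
    {P : ∀ i, Matrix (d i) (d i) ℝ}
    (hP : ∀ i, (P i).PosSemidef) {A B : ∀ i, Matrix n (d i) ℝ}
    (h : ∑ i, A i * P i * (B i)ᵀ = ∑ i, B i * P i * (B i)ᵀ) :
    (∑ i, B i * P i * (B i)ᵀ).trace ≤ (∑ i, A i * P i * (A i)ᵀ).trace := by
  have hnonneg : 0 ≤ (∑ i, (A i - B i) * P i * (A i - B i)ᵀ).trace := by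
    rw [trace_sum]
    exact Finset.sum_nonneg fun i _ => by
      simpa using ((hP i).mul_mul_conjTranspose_same (A i - B i)).trace_nonneg
  have hcross : (∑ i, B i * P i * (A i)ᵀ).trace = (∑ i, A i * P i * (B i)ᵀ).trace := by
    rw [← trace_transpose, transpose_sum]
    congr 1
    refine Finset.sum_congr rfl fun i _ => ?_
    have hPt : (P i)ᵀ = P i := by simpa using (hP i).isHermitian.eq
    rw [transpose_mul, transpose_mul, hPt, transpose_transpose, Matrix.mul_assoc]
  simp only [transpose_sub, Matrix.sub_mul, Matrix.mul_sub, Finset.sum_sub_distrib,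
    trace_sub, hcross, h] at hnonneg
  linarith

/-- minimum-variance optimality of the multi-model weights
`A_ℓ = M⁻¹ G_ℓᵀ P_ℓ⁻¹`: any weights satisfying the unbiasedness constraint
`∑ A_ℓ G_ℓ = I` give trace of error covariance at least `trace M⁻¹`, with
equality for the optimal weights. -/
theorem stmt_0 (n L : ℕ) (hn : 0 < n) (hL : 0 < L) (nd : Fin L → ℕ)
    (P : ∀ ℓ : Fin L, Matrix (Fin (nd ℓ)) (Fin (nd ℓ)) ℝ)
    (G : ∀ ℓ : Fin L, Matrix (Fin (nd ℓ)) (Fin n) ℝ)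
    (hP : ∀ ℓ, (P ℓ).PosDef)
    (M : Matrix (Fin n) (Fin n) ℝ)
    (hM : M = ∑ ℓ, (G ℓ)ᵀ * (P ℓ)⁻¹ * G ℓ)
    (hMinv : IsUnit M) :
    (∀ A : ∀ ℓ : Fin L, Matrix (Fin n) (Fin (nd ℓ)) ℝ,
        (∑ ℓ, A ℓ * G ℓ) = 1 →
        (M⁻¹).trace ≤ (∑ ℓ, A ℓ * P ℓ * (A ℓ)ᵀ).trace) ∧
    (∑ ℓ, (M⁻¹ * (G ℓ)ᵀ * (P ℓ)⁻¹) * P ℓ * (M⁻¹ * (G ℓ)ᵀ * (P ℓ)⁻¹)ᵀ).trace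
      = (M⁻¹).trace := by
  have hMt : Mᵀ = M := by rw [hM]; exact transpose_sum_transpose_mul_inv_mul hP G
  have hunbiased : ∑ ℓ, M⁻¹ * (G ℓ)ᵀ * (P ℓ)⁻¹ * G ℓ = 1 := by
    simp_rw [Matrix.mul_assoc M⁻¹]
    rw [← Finset.mul_sum, ← hM, nonsing_inv_mul _ ((isUnit_iff_isUnit_det M).1 hMinv)]
  have hopt := sum_mul_mul_transpose_optimalWeight hP G hMt hunbiased
  refine ⟨fun A hA => ?_, by rw [hopt]⟩
  have hcov := sum_mul_mul_transpose_optimalWeight hP G hMt hA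
  simpa only [hopt] using
    trace_sum_mul_mul_transpose_le (fun ℓ => (hP ℓ).posSemidef) (hcov.trans hopt.symm)
end

section
/- Let n, L be positive integers, and for each ℓ = 1,…,L let P_ℓ be a symmetric positive definite real n_ℓ × n_ℓ matrix and G_ℓ a real n_ℓ × n matrix, such that M := ∑_{ℓ=1}^L G_ℓᵀ P_ℓ⁻¹ G_ℓ is invertible. Then the system of equations A_ℓ P_ℓ + (1/2) Λ G_ℓᵀ = 0 for all ℓ = 1,…,L together with ∑_{ℓ=1}^L A_ℓ G_ℓ = I_n, in the unknowns A_ℓ ∈ ℝ^{n × n_ℓ} and Λ ∈ ℝ^{n × n}, has the unique solution A_ℓ = M⁻¹ G_ℓᵀ P_ℓ⁻¹ and Λ = −2 M⁻¹. -/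
open Matrix BigOperators

/-- the Lagrange stationarity system `A_ℓ P_ℓ + (1/2) Λ G_ℓᵀ = 0`
(for all ℓ) together with the unbiasedness constraint `∑ A_ℓ G_ℓ = I` has the
unique solution `A_ℓ = M⁻¹ G_ℓᵀ P_ℓ⁻¹`, `Λ = −2 M⁻¹`. -/
theorem stmt_2 (n L : ℕ) (hn : 0 < n) (hL : 0 < L) (nd : Fin L → ℕ)
    (P : ∀ ℓ : Fin L, Matrix (Fin (nd ℓ)) (Fin (nd ℓ)) ℝ)
    (G : ∀ ℓ : Fin L, Matrix (Fin (nd ℓ)) (Fin n) ℝ)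
    (hP : ∀ ℓ, (P ℓ).PosDef)
    (M : Matrix (Fin n) (Fin n) ℝ)
    (hM : M = ∑ ℓ, (G ℓ)ᵀ * (P ℓ)⁻¹ * G ℓ)
    (hMinv : IsUnit M)
    (A : ∀ ℓ : Fin L, Matrix (Fin n) (Fin (nd ℓ)) ℝ)
    (Λ : Matrix (Fin n) (Fin n) ℝ) :
    ((∀ ℓ, A ℓ * P ℓ + (1 / 2 : ℝ) • (Λ * (G ℓ)ᵀ) = 0) ∧ (∑ ℓ, A ℓ * G ℓ) = 1)
      ↔ ((∀ ℓ, A ℓ = M⁻¹ * (G ℓ)ᵀ * (P ℓ)⁻¹) ∧ Λ = (-2 : ℝ) • M⁻¹) := by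
  have hMdet : IsUnit M.det := (isUnit_iff_isUnit_det M).mp hMinv
  have hPdet : ∀ ℓ, IsUnit (P ℓ).det := fun ℓ => (isUnit_iff_isUnit_det _).mp (hP ℓ).isUnit
  have hsum : ∀ C : Matrix (Fin n) (Fin n) ℝ,
      ∑ ℓ, C * (G ℓ)ᵀ * (P ℓ)⁻¹ * G ℓ = C * M := by
    intro C
    simp only [hM, Matrix.mul_sum, Matrix.mul_assoc]
  constructor
  · rintro ⟨hA, hI⟩
    have hA' : ∀ ℓ, A ℓ = ((-1 / 2 : ℝ) • Λ) * (G ℓ)ᵀ * (P ℓ)⁻¹ := by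
      intro ℓ
      rw [← mul_nonsing_inv_cancel_right (P ℓ) (A ℓ) (hPdet ℓ),
        eq_neg_of_add_eq_zero_left (hA ℓ), Matrix.smul_mul, neg_div, neg_smul]
    simp only [hA', hsum] at hI
    have hΛ : (-1 / 2 : ℝ) • Λ = M⁻¹ := (inv_eq_left_inv hI).symm
    refine ⟨fun ℓ => by rw [hA', hΛ], ?_⟩
    rw [← hΛ, smul_smul]
    norm_num
  · rintro ⟨hA, rfl⟩
    refine ⟨fun ℓ => ?_, ?_⟩
    · rw [hA, nonsing_inv_mul_cancel_right _ _ (hPdet ℓ), Matrix.smul_mul, smul_smul]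
      norm_num
    · simp only [hA, hsum, nonsing_inv_mul M hMdet]
end

section
/- Let n, p, M be positive integers; let P₁ be a symmetric positive definite real n × n matrix and x₁ ∈ ℝⁿ; for m = 2,…,M let G_m be a real n_m × n matrix, P_m a symmetric positive definite real n_m × n_m matrix, and x_m ∈ ℝ^{n_m}; let H be a real p × n matrix, R a symmetric positive definite real p × p matrix, and y ∈ ℝᵖ. Perform the iterative procedure: starting from (x'₁, P'₁) = (x₁, P₁), sequentially update for m = 2,…,M via K_m := P'_{m−1} G_mᵀ (G_m P'_{m−1} G_mᵀ + P_m)⁻¹, x'_m := x'_{m−1} + K_m (x_m − G_m x'_{m−1}), P'_m := (Iₙ − K_m G_m) P'_{m−1}; then assimilate the observation via K := P'_M Hᵀ (H P'_M Hᵀ + R)⁻¹, x^a := x'_M + K (y − H x'_M), P^a := (Iₙ − K H) P'_M. Then P^a = (P₁⁻¹ + ∑_{m=2}^M G_mᵀ P_m⁻¹ G_m + Hᵀ R⁻¹ H)⁻¹ and x^a = P^a (P₁⁻¹ x₁ + ∑_{m=2}^M G_mᵀ P_m⁻¹ x_m + Hᵀ R⁻¹ y); i.e., the iterative solution of multi-model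 data assimilation equals the direct solution. -/
open Matrix BigOperators

namespace Matrix

variable {m n : Type*} [Fintype m] [Fintype n]
  {P : Matrix n n ℝ} {R : Matrix m m ℝ}

theorem PosDef.transpose_mul_mul_add (hP : P.PosDef) (hR : R.PosDef) (G : Matrix m n ℝ) :
    (P + Gᵀ * R * G).PosDef := by
  simpa using hP.add_posSemidef (hR.posSemidef.conjTranspose_mul_mul_same G)

variable [DecidableEq m] [DecidableEq n]

/-- The covariance after a Kalman update, in information form. -/
theorem kalman_covariance_eq (hP : P.PosDef) (hR : R.PosDef) (G : Matrix m n ℝ) :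
    (1 - (P * Gᵀ * (G * P * Gᵀ + R)⁻¹) * G) * P = (P⁻¹ + Gᵀ * R⁻¹ * G)⁻¹ := by
  have hS : (R + G * P * Gᵀ).PosDef := by
    simpa using hR.transpose_mul_mul_add hP Gᵀ
  have hPP : P⁻¹⁻¹ = P := nonsing_inv_nonsing_inv P ((isUnit_iff_isUnit_det P).1 hP.isUnit)
  have hRR : R⁻¹⁻¹ = R := nonsing_inv_nonsing_inv R ((isUnit_iff_isUnit_det R).1 hR.isUnit)
  rw [add_mul_mul_inv_eq_sub _ _ _ _ hP.inv.isUnit hR.inv.isUnit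
    (by rw [hPP, hRR]; exact hS.isUnit), hPP, hRR, sub_mul, one_mul, add_comm R]

/-- The Kalman gain, in information form. -/
theorem information_mul_kalman_gain (hP : P.PosDef) (hR : R.PosDef) (G : Matrix m n ℝ) :
    (P⁻¹ + Gᵀ * R⁻¹ * G) * (P * Gᵀ * (G * P * Gᵀ + R)⁻¹) = Gᵀ * R⁻¹ := by
  have hS : (G * P * Gᵀ + R).PosDef := by
    simpa [add_comm] using hR.transpose_mul_mul_add hP Gᵀ
  have hPd := (isUnit_iff_isUnit_det P).1 hP.isUnit
  have hRd := (isUnit_iff_isUnit_det R).1 hR.isUnit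
  have hSd := (isUnit_iff_isUnit_det _).1 hS.isUnit
  have key : (P⁻¹ + Gᵀ * R⁻¹ * G) * (P * Gᵀ) = Gᵀ * R⁻¹ * (G * P * Gᵀ + R) := by
    rw [Matrix.add_mul, nonsing_inv_mul_cancel_left _ _ hPd, Matrix.mul_add,
      nonsing_inv_mul_cancel_right _ _ hRd, add_comm]
    simp only [Matrix.mul_assoc]
  rw [← Matrix.mul_assoc, key, mul_nonsing_inv_cancel_right _ _ hSd]

/-- The mean after a Kalman update, in information form. -/
theorem information_mulVec_kalman_mean (hP : P.PosDef) (hR : R.PosDef) (G : Matrix m n ℝ)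
    (x : n → ℝ) (y : m → ℝ) :
    (P⁻¹ + Gᵀ * R⁻¹ * G) *ᵥ (x + (P * Gᵀ * (G * P * Gᵀ + R)⁻¹) *ᵥ (y - G *ᵥ x)) =
      P⁻¹ *ᵥ x + Gᵀ *ᵥ (R⁻¹ *ᵥ y) := by
  rw [mulVec_add, mulVec_mulVec, information_mul_kalman_gain hP hR, add_mulVec, mulVec_sub,
    mulVec_mulVec, mulVec_mulVec]
  abel

end Matrix

theorem Fin.eq_add_sum_of_forall_succ {A : Type*} [AddCommMonoid A] (f : ℕ → A) :
    ∀ {K : ℕ} (g : Fin K → A), (∀ i : Fin K, f ((i : ℕ) + 1) = f i + g i) →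
      f K = f 0 + ∑ i, g i
  | 0, _, _ => by simp
  | K + 1, g, h => by
    rw [Fin.sum_univ_castSucc, ← add_assoc,
      ← Fin.eq_add_sum_of_forall_succ f (fun i : Fin K => g i.castSucc) fun i => h i.castSucc]
    exact h (Fin.last K)

/-- the iterative solution of multi-model data assimilation
equals the direct solution. The reference model 1 has forecast `x₁` with
covariance `P₁`; the additional models `m = 2, …, M` are indexed by
`i : Fin K` (`K = M − 1`). After sequentially assimilating all model
forecasts via Kalman updates, and finally the observation `y` (operator `H`,
covariance `R`), the analysis `(x^a, P^a)` equals the direct precision-weighted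
solution. -/
theorem stmt_11 (n p K : ℕ) (hn : 0 < n) (hp : 0 < p) (nd : Fin K → ℕ)
    (G : ∀ i : Fin K, Matrix (Fin (nd i)) (Fin n) ℝ)
    (P : ∀ i : Fin K, Matrix (Fin (nd i)) (Fin (nd i)) ℝ)
    (hP : ∀ i, (P i).PosDef)
    (xm : ∀ i : Fin K, Fin (nd i) → ℝ)
    (P₁ : Matrix (Fin n) (Fin n) ℝ) (hP₁ : P₁.PosDef) (x₁ : Fin n → ℝ)
    (H : Matrix (Fin p) (Fin n) ℝ)
    (R : Matrix (Fin p) (Fin p) ℝ) (hR : R.PosDef) (y : Fin p → ℝ)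
    (x' : ℕ → Fin n → ℝ) (P' : ℕ → Matrix (Fin n) (Fin n) ℝ)
    (hx0 : x' 0 = x₁) (hP0 : P' 0 = P₁)
    (hstep : ∀ i : Fin K,
      x' ((i : ℕ) + 1) = x' i +
        (P' i * (G i)ᵀ * (G i * P' i * (G i)ᵀ + P i)⁻¹) *ᵥ (xm i - G i *ᵥ x' i) ∧
      P' ((i : ℕ) + 1) =
        (1 - (P' i * (G i)ᵀ * (G i * P' i * (G i)ᵀ + P i)⁻¹) * G i) * P' i)
    (Kg : Matrix (Fin n) (Fin p) ℝ)
    (hKg : Kg = P' K * Hᵀ * (H * P' K * Hᵀ + R)⁻¹)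
    (xa : Fin n → ℝ) (hxa : xa = x' K + Kg *ᵥ (y - H *ᵥ x' K))
    (Pa : Matrix (Fin n) (Fin n) ℝ) (hPa : Pa = (1 - Kg * H) * P' K) :
    Pa = (P₁⁻¹ + (∑ i : Fin K, (G i)ᵀ * (P i)⁻¹ * G i) + Hᵀ * R⁻¹ * H)⁻¹ ∧
    xa = Pa *ᵥ (P₁⁻¹ *ᵥ x₁ + (∑ i : Fin K, (G i)ᵀ *ᵥ ((P i)⁻¹ *ᵥ xm i))
        + Hᵀ *ᵥ (R⁻¹ *ᵥ y)) := by
  have hpd : ∀ k ≤ K, (P' k).PosDef := by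
    intro k
    induction k with
    | zero => intro _; rwa [hP0]
    | succ k ih =>
      intro hk
      have hPk := ih (by omega)
      rw [(hstep ⟨k, hk⟩).2, kalman_covariance_eq hPk (hP _)]
      exact (hPk.inv.transpose_mul_mul_add (hP _).inv _).inv
  have hinv : ∀ i : Fin K, (P' ((i : ℕ) + 1))⁻¹ = (P' i)⁻¹ + (G i)ᵀ * (P i)⁻¹ * G i := by
    intro i
    have hPi := hpd i i.is_lt.le
    rw [(hstep i).2, kalman_covariance_eq hPi (hP i), nonsing_inv_nonsing_inv]
    exact (isUnit_iff_isUnit_det _).1 (hPi.inv.transpose_mul_mul_add (hP i).inv _).isUnit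
  have hmean : ∀ i : Fin K, (P' ((i : ℕ) + 1))⁻¹ *ᵥ x' ((i : ℕ) + 1) =
      (P' i)⁻¹ *ᵥ x' i + (G i)ᵀ *ᵥ ((P i)⁻¹ *ᵥ xm i) := by
    intro i
    rw [hinv, (hstep i).1, information_mulVec_kalman_mean (hpd i i.is_lt.le) (hP i)]
  have hinvK := Fin.eq_add_sum_of_forall_succ (fun k => (P' k)⁻¹) _ hinv
  have hmeanK := Fin.eq_add_sum_of_forall_succ (fun k => (P' k)⁻¹ *ᵥ x' k) _ hmean
  simp only [hP0, hx0] at hinvK hmeanK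
  have hPK := hpd K le_rfl
  have hPa' : Pa = ((P' K)⁻¹ + Hᵀ * R⁻¹ * H)⁻¹ := by
    rw [hPa, hKg, kalman_covariance_eq hPK hR]
  refine ⟨by rw [hPa', hinvK], ?_⟩
  rw [← hmeanK, ← information_mulVec_kalman_mean hPK hR, ← hKg, ← hxa, hPa', mulVec_mulVec,
    nonsing_inv_mul _ ((isUnit_iff_isUnit_det _).1
      (hPK.inv.transpose_mul_mul_add hR.inv H).isUnit), one_mulVec]
end

section
/- Let n, p, M be positive integers; let P₁ be a symmetric positive definite real n × n matrix and x₁ ∈ ℝⁿ; for m = 2,…,M let G_m be a real n_m × n matrix, P_m a symmetric positive definite real n_m × n_m matrix, and x_m ∈ ℝ^{n_m}; let H be a real p × n matrix, R a symmetric positive definite real p × p matrix, and y ∈ ℝᵖ. For any permutation σ of {2,…,M}, perform the iterative procedure starting from (x₁, P₁) and assimilating the model forecasts in the order σ(2),…,σ(M) (via K := P' G_{σ(m)}ᵀ (G_{σ(m)} P' G_{σ(m)}ᵀ + P_{σ(m)})⁻¹, x' ← x' + K(x_{σ(m)} − G_{σ(m)} x'), P' ← (Iₙ − K G_{σ(m)})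 P'), followed by assimilating the observation y via the Kalman update with operator H and covariance R. Then the resulting analysis pair (x^a, P^a) is the same for every permutation σ. -/
open Matrix BigOperators

/-- One Kalman update of a state–covariance pair `s = (x', P')` in the
reference space `ℝⁿ`, assimilating the forecast `xm` of a model with map `G`
and forecast error covariance `P` as an observation:
`K = P' Gᵀ (G P' Gᵀ + P)⁻¹`, `x' ← x' + K (xm − G x')`,
`P' ← (I − K G) P'`. -/
noncomputable def mmKalmanStep {n nm : ℕ} (G : Matrix (Fin nm) (Fin n) ℝ)
    (P : Matrix (Fin nm) (Fin nm) ℝ) (xm : Fin nm → ℝ)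
    (s : (Fin n → ℝ) × Matrix (Fin n) (Fin n) ℝ) :
    (Fin n → ℝ) × Matrix (Fin n) (Fin n) ℝ :=
  (s.1 + (s.2 * Gᵀ * (G * s.2 * Gᵀ + P)⁻¹) *ᵥ (xm - G *ᵥ s.1),
   (1 - (s.2 * Gᵀ * (G * s.2 * Gᵀ + P)⁻¹) * G) * s.2)

/-- The information (inverse-covariance) form `(P'⁻¹ x', P'⁻¹)` of a state–covariance pair. -/
noncomputable def informationPair {n : ℕ} (s : (Fin n → ℝ) × Matrix (Fin n) (Fin n) ℝ) :
    (Fin n → ℝ) × Matrix (Fin n) (Fin n) ℝ :=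
  (s.2⁻¹ *ᵥ s.1, s.2⁻¹)

/-- The increment a Kalman update adds to the information pair. -/
noncomputable def informationGain {n m : ℕ} (G : Matrix (Fin m) (Fin n) ℝ)
    (P : Matrix (Fin m) (Fin m) ℝ) (x : Fin m → ℝ) :
    (Fin n → ℝ) × Matrix (Fin n) (Fin n) ℝ :=
  ((Gᵀ * P⁻¹) *ᵥ x, Gᵀ * P⁻¹ * G)

theorem informationPair_inj {n : ℕ} {s t : (Fin n → ℝ) × Matrix (Fin n) (Fin n) ℝ}
    (hs : s.2.PosDef) (ht : t.2.PosDef) (h : informationPair s = informationPair t) : s = t := by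
  obtain ⟨x, A⟩ := s
  obtain ⟨y, B⟩ := t
  simp only [informationPair, Prod.mk.injEq] at h hs ht
  obtain ⟨h₁, h₂⟩ := h
  have hA : IsUnit A.det := (isUnit_iff_isUnit_det A).mp hs.isUnit
  have hAB : A = B := inv_inj h₂ hA
  subst hAB
  have h₃ := congrArg (fun v => A *ᵥ v) h₁
  simp only [mulVec_mulVec, mul_nonsing_inv A hA, one_mulVec] at h₃
  rw [h₃]

theorem mmKalmanStep_posDef_and_informationPair {n m : ℕ} (G : Matrix (Fin m) (Fin n) ℝ)
    {P : Matrix (Fin m) (Fin m) ℝ} (hP : P.PosDef) (x : Fin m → ℝ)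
    {s : (Fin n → ℝ) × Matrix (Fin n) (Fin n) ℝ} (hs : s.2.PosDef) :
    (mmKalmanStep G P x s).2.PosDef ∧
      informationPair (mmKalmanStep G P x s) = informationPair s + informationGain G P x := by
  obtain ⟨u, B⟩ := s
  simp only at hs
  have hS : (G * B * Gᵀ + P).PosDef := by
    have := hs.posSemidef.mul_mul_conjTranspose_same G
    rw [conjTranspose_eq_transpose_of_trivial] at this
    exact PosDef.posSemidef_add this hP
  have hA : (B⁻¹ + Gᵀ * P⁻¹ * G).PosDef := by
    have := hP.inv.posSemidef.conjTranspose_mul_mul_same G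
    rw [conjTranspose_eq_transpose_of_trivial] at this
    exact hs.inv.add_posSemidef this
  have hBu : IsUnit B.det := (isUnit_iff_isUnit_det B).mp hs.isUnit
  have hPu : IsUnit P.det := (isUnit_iff_isUnit_det P).mp hP.isUnit
  have hSu := (isUnit_iff_isUnit_det _).mp hS.isUnit
  have hAS : (B⁻¹ + Gᵀ * P⁻¹ * G) * (B * Gᵀ) = Gᵀ * P⁻¹ * (G * B * Gᵀ + P) := by
    rw [Matrix.add_mul, Matrix.mul_add, nonsing_inv_mul_cancel_left _ _ hBu,
      nonsing_inv_mul_cancel_right _ _ hPu, add_comm]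
    simp only [Matrix.mul_assoc]
  have hAK : (B⁻¹ + Gᵀ * P⁻¹ * G) * (B * Gᵀ * (G * B * Gᵀ + P)⁻¹) = Gᵀ * P⁻¹ := by
    rw [← Matrix.mul_assoc, hAS, mul_nonsing_inv_cancel_right _ _ hSu]
  have hinv : (B⁻¹ + Gᵀ * P⁻¹ * G) * (mmKalmanStep G P x (u, B)).2 = 1 := by
    simp only [mmKalmanStep]
    rw [← Matrix.mul_assoc, mul_sub, mul_one, ← Matrix.mul_assoc _ _ G, hAK, add_sub_cancel_right,
      nonsing_inv_mul _ hBu]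
  have hstep : (mmKalmanStep G P x (u, B)).2 = (B⁻¹ + Gᵀ * P⁻¹ * G)⁻¹ :=
    (inv_eq_right_inv hinv).symm
  refine ⟨hstep ▸ hA.inv, ?_⟩
  have hstep' : (mmKalmanStep G P x (u, B)).2⁻¹ = B⁻¹ + Gᵀ * P⁻¹ * G := inv_eq_left_inv hinv
  refine Prod.ext ?_ hstep'
  simp only [informationPair, informationGain, Prod.mk_add_mk, hstep']
  simp only [mmKalmanStep]
  rw [mulVec_add, mulVec_mulVec, hAK, mulVec_sub, mulVec_mulVec, add_mulVec]
  abel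

theorem foldl_mmKalmanStep_posDef_and_informationPair {ι : Type*} {n : ℕ} {d : ι → ℕ}
    (G : ∀ i, Matrix (Fin (d i)) (Fin n) ℝ) {P : ∀ i, Matrix (Fin (d i)) (Fin (d i)) ℝ}
    (hP : ∀ i, (P i).PosDef) (x : ∀ i, Fin (d i) → ℝ) (l : List ι)
    {s : (Fin n → ℝ) × Matrix (Fin n) (Fin n) ℝ} (hs : s.2.PosDef) :
    (l.foldl (fun s i => mmKalmanStep (G i) (P i) (x i) s) s).2.PosDef ∧
      informationPair (l.foldl (fun s i => mmKalmanStep (G i) (P i) (x i) s) s) =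
        informationPair s + (l.map fun i => informationGain (G i) (P i) (x i)).sum := by
  induction l generalizing s with
  | nil => simpa using hs
  | cons i l ih =>
    obtain ⟨hpos, hinfo⟩ := mmKalmanStep_posDef_and_informationPair (G i) (hP i) (x i) hs
    obtain ⟨hpos', hinfo'⟩ := ih hpos
    refine ⟨hpos', ?_⟩
    rw [List.foldl_cons, hinfo', hinfo, List.map_cons, List.sum_cons, add_assoc]

/-- order independence of the iterative multi-model
assimilation. The reference model 1 has forecast `x₁` with covariance `P₁`;
the additional models `m = 2, …, M` are indexed by `i : Fin K` (`K = M − 1`).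
For any permutation `σ` of the additional models, assimilate their forecasts
sequentially in the order `σ 0, σ 1, …`, then assimilate the observation `y`
(operator `H`, covariance `R`) by a Kalman update. The resulting analysis
pair `(x^a, P^a)` is the same for every permutation. -/
theorem stmt_12 (n p K : ℕ) (hn : 0 < n) (hp : 0 < p) (nd : Fin K → ℕ)
    (G : ∀ i : Fin K, Matrix (Fin (nd i)) (Fin n) ℝ)
    (P : ∀ i : Fin K, Matrix (Fin (nd i)) (Fin (nd i)) ℝ)
    (hP : ∀ i, (P i).PosDef)
    (xm : ∀ i : Fin K, Fin (nd i) → ℝ)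
    (P₁ : Matrix (Fin n) (Fin n) ℝ) (hP₁ : P₁.PosDef) (x₁ : Fin n → ℝ)
    (H : Matrix (Fin p) (Fin n) ℝ)
    (R : Matrix (Fin p) (Fin p) ℝ) (hR : R.PosDef) (y : Fin p → ℝ)
    (run : Equiv.Perm (Fin K) → (Fin n → ℝ) × Matrix (Fin n) (Fin n) ℝ)
    (hrun : ∀ σ : Equiv.Perm (Fin K),
      run σ = mmKalmanStep H R y
        ((List.ofFn fun j => σ j).foldl
          (fun s i => mmKalmanStep (G i) (P i) (xm i) s) (x₁, P₁)))
    (σ₁ σ₂ : Equiv.Perm (Fin K)) :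
    run σ₁ = run σ₂ := by
  have hfold (σ : Equiv.Perm (Fin K)) :=
    foldl_mmKalmanStep_posDef_and_informationPair G hP xm (List.ofFn fun j => σ j)
      (s := (x₁, P₁)) hP₁
  have hsum (σ : Equiv.Perm (Fin K)) :
      ((List.ofFn fun j => σ j).map fun i => informationGain (G i) (P i) (xm i)).sum =
        ∑ i, informationGain (G i) (P i) (xm i) := by
    rw [List.map_ofFn, List.sum_ofFn]
    exact Equiv.sum_comp σ fun i => informationGain (G i) (P i) (xm i)
  rw [hrun, hrun]
  congr 1
  refine informationPair_inj (hfold σ₁).1 (hfold σ₂).1 ?_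
  rw [(hfold σ₁).2, (hfold σ₂).2, hsum, hsum]
end

section
/- Let n be a positive integer, ε a real number, and C a real symmetric n × n matrix with spectral decomposition C = U D Uᵀ, where U is orthogonal and D = diag(λ₁,…,λₙ) is diagonal. Let D_ε := diag(max(λ₁, ε),…,max(λₙ, ε)) and C_ε := U D_ε Uᵀ. Then C_ε is symmetric with smallest eigenvalue ≥ ε, and for every real symmetric n × n matrix X whose smallest eigenvalue is ≥ ε, one has ‖C − C_ε‖_F ≤ ‖C − X‖_F, where ‖·‖_F is the Frobenius norm; i.e., C_ε is a nearest matrix to C, in the Frobenius norm, among symmetric matrices with eigenvalues bounded below by ε. -/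
open Matrix BigOperators

/-- The sum of the squared entries of a real matrix is the trace of `A * Aᵀ`. -/
theorem sum_sq_eq_trace_mul_transpose {m n : Type*} [Fintype m] [Fintype n]
    (A : Matrix m n ℝ) : ∑ i, ∑ j, A i j ^ 2 = (A * Aᵀ).trace := by
  simp [Matrix.trace, Matrix.mul_apply, sq]

/-- The sum of the squared entries is invariant under orthogonal conjugation. -/
theorem sum_sq_orthogonal_conj {n : Type*} [Fintype n] [DecidableEq n]
    {U : Matrix n n ℝ} (hU : Uᵀ * U = 1) (B : Matrix n n ℝ) :
    ∑ i, ∑ j, (U * B * Uᵀ) i j ^ 2 = ∑ i, ∑ j, B i j ^ 2 := by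
  rw [sum_sq_eq_trace_mul_transpose, sum_sq_eq_trace_mul_transpose]
  have h : U * B * Uᵀ * (U * B * Uᵀ)ᵀ = U * (B * (Uᵀ * U) * Bᵀ * Uᵀ) := by
    simp only [Matrix.transpose_mul, Matrix.transpose_transpose, Matrix.mul_assoc]
  rw [h, hU, Matrix.trace_mul_comm, Matrix.mul_one, Matrix.mul_assoc, hU, Matrix.mul_one]

/-- Among all matrices whose diagonal entries are at least `ε`, a nearest one to `diagonal d`
is obtained by raising the entries of `d` to `ε`. -/
theorem sum_sq_diagonal_sub_max_le {n : Type*} [Fintype n] [DecidableEq n]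
    (d : n → ℝ) {ε : ℝ} {Y : Matrix n n ℝ} (hY : ∀ i, ε ≤ Y i i) :
    ∑ i, ∑ j, (Matrix.diagonal d - Matrix.diagonal (fun i => max (d i) ε)) i j ^ 2 ≤
      ∑ i, ∑ j, (Matrix.diagonal d - Y) i j ^ 2 := by
  refine Finset.sum_le_sum fun i _ => Finset.sum_le_sum fun j _ => ?_
  rcases eq_or_ne i j with rfl | hij
  · simp only [Matrix.sub_apply, Matrix.diagonal_apply_eq]
    rcases le_total (d i) ε with h | h
    · rw [max_eq_right h]
      nlinarith [hY i]
    · simp [max_eq_left h, sq_nonneg]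
  · simp [hij, sq_nonneg]

/-- given a spectral decomposition `C = U D Uᵀ` of a real
symmetric matrix (`U` orthogonal, `D = diagonal λ`), the matrix
`C_ε = U D_ε Uᵀ` obtained by raising all eigenvalues below `ε` to `ε`
is symmetric with smallest eigenvalue ≥ ε (expressed as `C_ε − ε I ⪰ 0`),
and it is nearest to `C` in the Frobenius norm among all real symmetric
matrices `X` with smallest eigenvalue ≥ ε (i.e., `X − ε I ⪰ 0`). -/
theorem stmt_19 (n : ℕ) (hn : 0 < n) (ε : ℝ)
    (C U : Matrix (Fin n) (Fin n) ℝ)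
    (lam : Fin n → ℝ)
    (hCsymm : Cᵀ = C)
    (hU : U * Uᵀ = 1) (hU' : Uᵀ * U = 1)
    (hC : C = U * Matrix.diagonal lam * Uᵀ)
    (Cε : Matrix (Fin n) (Fin n) ℝ)
    (hCε : Cε = U * Matrix.diagonal (fun i => max (lam i) ε) * Uᵀ) :
    Cεᵀ = Cε ∧ (Cε - ε • (1 : Matrix (Fin n) (Fin n) ℝ)).PosSemidef ∧
    ∀ X : Matrix (Fin n) (Fin n) ℝ, Xᵀ = X →
      (X - ε • (1 : Matrix (Fin n) (Fin n) ℝ)).PosSemidef →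
      Real.sqrt (∑ i, ∑ j, (C i j - Cε i j) ^ 2) ≤
        Real.sqrt (∑ i, ∑ j, (C i j - X i j) ^ 2) := by
  subst hCε
  refine ⟨by simp [Matrix.mul_assoc], ?_, fun X _ hX => Real.sqrt_le_sqrt ?_⟩
  · have hshift : U * Matrix.diagonal (fun i => max (lam i) ε) * Uᵀ - ε • 1 =
        U * Matrix.diagonal (fun i => max (lam i) ε - ε) * Uᴴ := by
      rw [← Matrix.diagonal_sub, ← Matrix.smul_one_eq_diagonal, Matrix.mul_sub, Matrix.sub_mul]
      simp [hU]
    rw [hshift]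
    exact (Matrix.PosSemidef.diagonal fun i => by simp).mul_mul_conjTranspose_same U
  · have hY : ∀ i, ε ≤ (Uᵀ * X * U) i i := fun i => by
      have hpsd := (hX.conjTranspose_mul_mul_same U).diag_nonneg (i := i)
      simpa [Matrix.mul_sub, Matrix.sub_mul, hU'] using hpsd
    have hX_conj : X = U * (Uᵀ * X * U) * Uᵀ := by
      calc X = (U * Uᵀ) * X * (U * Uᵀ) := by simp [hU]
        _ = U * (Uᵀ * X * U) * Uᵀ := by simp only [Matrix.mul_assoc]
    have hle := sum_sq_diagonal_sub_max_le lam hY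
    rw [← sum_sq_orthogonal_conj hU', ← sum_sq_orthogonal_conj hU' (_ - Uᵀ * X * U)] at hle
    simpa only [Matrix.mul_sub, Matrix.sub_mul, ← hX_conj, ← hC, Matrix.sub_apply] using hle
end
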